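/- The image of 𝒲 under φ is φ(𝒲) = {(x₁ + i·y₁, x₂ + i·y₂) ∈ ℂ × ℂ : x₁ > 0 and x₂ < x₁² − y₂²/(4·x₁²)} (here x₁, y₁, x₂, y₂ range over ℝ). -/

import Mathlib

open Matrix Complex

/-- The tube `𝒯` over the future light cone, inside the space of symmetric
complex `2×2` matrices. -/
def lightConeTube : Set (Matrix (Fin 2) (Fin 2) ℂ) :=
  {z | zᵀ = z ∧ (z + z.map (starRingEnd ℂ)).det = 0 ∧ 0 < (Matrix.trace z).re}

/-- The future light cone `𝒞` in the space of real symmetric `2×2` matrices. -/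
def lightCone : Set (Matrix (Fin 2) (Fin 2) ℝ) :=
  {c | cᵀ = c ∧ c.det = 0 ∧ 0 < Matrix.trace c}

/-- The hypersurface `𝒩 = {c + i(rc + s·1) : c ∈ 𝒞, r, s ∈ ℝ} ⊆ 𝒯`. -/
def hypersurfN : Set (Matrix (Fin 2) (Fin 2) ℂ) :=
  {z | ∃ c ∈ lightCone, ∃ r s : ℝ,
    z = c.map (Complex.ofReal)
        + Complex.I • ((r • c + s • (1 : Matrix (Fin 2) (Fin 2) ℝ)).map (Complex.ofReal))}

/-- The complement `𝒲 = 𝒯 \ 𝒩`. -/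
def openW : Set (Matrix (Fin 2) (Fin 2) ℂ) := lightConeTube \ hypersurfN

/-- The `SO(2)`-invariant holomorphic map `φ(z) = (tr z, tr(z²) − (tr z)²)`,
with `tr` the normalized trace. -/
noncomputable def phiMap (z : Matrix (Fin 2) (Fin 2) ℂ) : ℂ × ℂ :=
  (Matrix.trace z / 2, Matrix.trace (z * z) / 2 - (Matrix.trace z / 2) ^ 2)

/-- The image of `𝒲 = 𝒯 \ 𝒩` under `φ`. -/
theorem phi_image_W :
    phiMap '' openW =
      {p : ℂ × ℂ | 0 < p.1.re ∧ p.2.re < p.1.re ^ 2 - p.2.im ^ 2 / (4 * p.1.re ^ 2)} := by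
  ext ⟨w, t⟩
  simp only [Set.mem_image, Set.mem_setOf_eq]
  constructor
  · rintro ⟨z, ⟨⟨hsym, hdet, htr⟩, hN⟩, hz⟩
    have h10 : z 1 0 = z 0 1 := congrFun (congrFun hsym 0) 1
    simp only [phiMap, Prod.mk.injEq, Matrix.trace_fin_two, Matrix.mul_apply,
      Fin.sum_univ_two, h10] at hz
    simp only [Matrix.trace_fin_two, Complex.add_re] at htr
    simp only [Matrix.det_fin_two, Matrix.add_apply, Matrix.map_apply, h10,
      Complex.add_conj] at hdet
    obtain ⟨a1, ha1⟩ : ∃ x, x = (z 0 0).re := ⟨_, rfl⟩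
    obtain ⟨a2, ha2⟩ : ∃ x, x = (z 0 0).im := ⟨_, rfl⟩
    obtain ⟨b1, hb1⟩ : ∃ x, x = (z 0 1).re := ⟨_, rfl⟩
    obtain ⟨b2, hb2⟩ : ∃ x, x = (z 0 1).im := ⟨_, rfl⟩
    obtain ⟨d1, hd1⟩ : ∃ x, x = (z 1 1).re := ⟨_, rfl⟩
    obtain ⟨d2, hd2⟩ : ∃ x, x = (z 1 1).im := ⟨_, rfl⟩
    have hA : z 0 0 = ⟨a1, a2⟩ := by rw [ha1, ha2]
    have hB : z 0 1 = ⟨b1, b2⟩ := by rw [hb1, hb2]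
    have hD : z 1 1 = ⟨d1, d2⟩ := by rw [hd1, hd2]
    have hd : a1 * d1 = b1 * b1 := by
      rw [← ha1, ← hb1, ← hd1] at hdet
      norm_cast at hdet
      linarith
    rw [← ha1, ← hd1] at htr
    have hne : (a1 - d1) * b2 - b1 * (a2 - d2) ≠ 0 := by
      intro h0
      apply hN
      have hs : a1 + d1 ≠ 0 := htr.ne'
      obtain ⟨r, hr⟩ : ∃ r, r = ((a1 - d1) * (a2 - d2) + 4 * b1 * b2) / (a1 + d1) ^ 2 :=
        ⟨_, rfl⟩
      have e1 : r * b1 = b2 := by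
        rw [hr]; field_simp
        linear_combination (-(a1 - d1)) * h0 - 4 * b2 * hd
      have e2 : r * (a1 - d1) = a2 - d2 := by
        rw [hr]; field_simp
        linear_combination (4 * b1) * h0 - 4 * (a2 - d2) * hd
      refine ⟨!![a1, b1; b1, d1], ⟨?_, ?_, ?_⟩, r, a2 - r * a1, ?_⟩
      · ext i j; fin_cases i <;> fin_cases j <;> rfl
      · rw [Matrix.det_fin_two_of]; linarith
      · rw [Matrix.trace_fin_two_of]; exact htr
      · ext i j
        fin_cases i <;> fin_cases j <;>
          simp [hA, hB, hD, h10, Complex.ext_iff] <;> linarith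
    obtain ⟨hw, ht⟩ := hz
    rw [hA, hD] at hw
    rw [hA, hB, hD] at ht
    have hwre : w.re = (a1 + d1) / 2 := by
      rw [← hw]; simp
    have htre : t.re = ((a1 + d1) / 2) ^ 2 - (((a2 - d2) / 2) ^ 2 + b2 ^ 2) := by
      rw [← ht]; simp [pow_two]; linear_combination (-1) * hd
    have htim : t.im = ((a1 - d1) * (a2 - d2) / 2 + 2 * b1 * b2) := by
      rw [← ht]; simp [pow_two]; ring
    refine ⟨by rw [hwre]; linarith, ?_⟩
    rw [hwre, htre, htim, sub_lt_sub_iff_left, div_lt_iff₀ (by positivity)]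
    have := sq_pos_of_ne_zero hne
    have hd2' : (a1 + d1) ^ 2 = (a1 - d1) ^ 2 + 4 * b1 ^ 2 := by linear_combination 4 * hd
    have : (((a2 - d2) / 2) ^ 2 + b2 ^ 2) * (4 * ((a1 + d1) / 2) ^ 2)
        = ((a1 - d1) * (a2 - d2) / 2 + 2 * b1 * b2) ^ 2
          + ((a1 - d1) * b2 - b1 * (a2 - d2)) ^ 2 := by
      linear_combination (((a2 - d2) / 2) ^ 2 + b2 ^ 2) * hd2'
    linarith
  · rintro ⟨hw, ht⟩
    obtain ⟨a, b⟩ := w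
    obtain ⟨x, y⟩ := t
    simp only at hw ht
    obtain ⟨m, hm⟩ : ∃ m, m = y / (2 * a) := ⟨_, rfl⟩
    have hy : y = 2 * a * m := by rw [hm]; field_simp
    have hpos : 0 < a ^ 2 - x - m ^ 2 := by
      have : m ^ 2 = y ^ 2 / (4 * a ^ 2) := by rw [hm, div_pow]; ring
      rw [this]; linarith
    obtain ⟨n, hn⟩ : ∃ n, n = Real.sqrt (a ^ 2 - x - m ^ 2) := ⟨_, rfl⟩
    have hn0 : 0 < n := by rw [hn]; exact Real.sqrt_pos.mpr hpos
    have hnn : n ^ 2 = a ^ 2 - x - m ^ 2 := by rw [hn]; exact Real.sq_sqrt hpos.le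
    refine ⟨!![⟨2 * a, b + m⟩, ⟨0, n⟩; ⟨0, n⟩, ⟨0, b - m⟩], ⟨⟨?_, ?_, ?_⟩, ?_⟩, ?_⟩
    · ext i j; fin_cases i <;> fin_cases j <;> rfl
    · simp [Matrix.det_fin_two, Complex.ext_iff]
    · rw [Matrix.trace_fin_two_of]; simpa using hw
    · rintro ⟨c, -, r, s, h⟩
      have h01 := congrFun (congrFun h 0) 1
      simp [Complex.ext_iff] at h01
      obtain ⟨h1, h2⟩ := h01
      rw [← h1] at h2
      simp at h2
      exact hn0.ne' h2
    · simp only [phiMap, Prod.mk.injEq, Matrix.trace_fin_two, Matrix.mul_apply,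
        Fin.sum_univ_two]
      constructor
      · simp [Complex.ext_iff]
      · simp [Complex.ext_iff, pow_two]
        constructor
        · linear_combination (-1) * hnn
        · rw [hy]; ring
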